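/- arXiv:2505.11012 — 6 statements merged into one kernel-verified Lean document; each statement's English description precedes it below -/
import Mathlib

section
/- Let N ≥ 1 and let w_0, ..., w_{2N−2} be nonnegative reals with Σ_{r=0}^{2N−2} w_r = 1. Let χ: Z_{2N−1} → {0,1} be the indicator of {0,1,...,N−1}, i.e. χ(s) = 1 if 0 ≤ s ≤ N−1 and χ(s) = 0 if N ≤ s ≤ 2N−2. Then Σ_{s=0}^{2N−2} ( Σ_{r=0}^{2N−2} w_r · χ(s+r mod (2N−1)) )² = N − Σ_{s=0}^{2N−2} Σ_{t=0}^{2N−2} τ_{s,t,N} · w_s · w_t, where τ_{s,t,N} = min(|t−s|, 2N−1−|t−s|). -/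
/-- `tau N s t = min(|t-s|, 2N-1-|t-s|)`, the cyclic distance in `ℤ_{2N-1}`. -/
def tau (N s t : ℕ) : ℕ :=
  min (Int.natAbs ((t : ℤ) - (s : ℤ))) (2 * N - 1 - Int.natAbs ((t : ℤ) - (s : ℤ)))

/-- The number of positions in which two cyclic translates, by `a` and `a + d`, of the window
`{0,…,N-1}` inside `ℤ_{2N-1}` overlap. -/
theorem card_overlap_add (N a d : ℕ) (hd : d < 2 * N - 1) :
    ((Finset.range (2 * N - 1)).filter fun s =>
      (s + a) % (2 * N - 1) < N ∧ (s + (a + d)) % (2 * N - 1) < N).card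
      = (N - d) + (d + 1 - N) := by
  set M := 2 * N - 1 with hM
  let q : ℕ → Prop := fun u => u % M < N ∧ (u + d) % M < N
  have hq : Function.Periodic q M := fun u => by
    simp only [q, Nat.add_mod_right, add_right_comm u M d]
  have hshift : ((Finset.range M).filter fun s => (s + a) % M < N ∧ (s + (a + d)) % M < N).card
      = ((Finset.Ico a (a + M)).filter q).card := by
    refine Finset.card_bij (fun s _ => s + a) ?_ (by simp) ?_
    · intro s hs
      simp only [Finset.mem_filter, Finset.mem_range, Finset.mem_Ico, q, add_assoc] at hs ⊢
      exact ⟨by omega, hs.2⟩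
    · intro u hu
      simp only [Finset.mem_filter, Finset.mem_Ico, q] at hu
      have hua : u - a + a = u := by omega
      refine ⟨u - a, ?_, hua⟩
      simp only [Finset.mem_filter, Finset.mem_range, ← add_assoc, hua]
      exact ⟨by omega, hu.2⟩
  have hwindow : (Finset.range M).filter q = Finset.range (N - d) ∪ Finset.Ico (M - d) N := by
    ext u
    simp only [Finset.mem_filter, Finset.mem_range, Finset.mem_union, Finset.mem_Ico, q]
    rcases lt_or_ge u M with hu | hu
    · rw [Nat.mod_eq_of_lt hu]
      rcases lt_or_ge (u + d) M with h | h
      · rw [Nat.mod_eq_of_lt h]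
        omega
      · rw [Nat.mod_eq_sub_mod h, Nat.mod_eq_of_lt (by omega)]
        omega
    · omega
  have hdisj : Disjoint (Finset.range (N - d)) (Finset.Ico (M - d) N) := by
    rw [Finset.disjoint_left]
    intro u
    simp only [Finset.mem_range, Finset.mem_Ico]
    omega
  rw [hshift, Nat.filter_Ico_card_eq_of_periodic a M q hq, Nat.count_eq_card_filter_range, hwindow,
    Finset.card_union_of_disjoint hdisj, Finset.card_range, Nat.card_Ico]
  omega

/-- Two cyclic translates of the window `{0,…,N-1}` inside `ℤ_{2N-1}` overlap in
`N - tau N a b` positions. -/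
theorem card_overlap_add_tau (N a b : ℕ) (ha : a < 2 * N - 1) (hb : b < 2 * N - 1) :
    ((Finset.range (2 * N - 1)).filter fun s =>
      (s + a) % (2 * N - 1) < N ∧ (s + b) % (2 * N - 1) < N).card + tau N a b = N := by
  rcases le_total a b with h | h
  · obtain ⟨d, rfl⟩ := Nat.exists_eq_add_of_le h
    rw [card_overlap_add N a d (by omega), tau]
    omega
  · obtain ⟨d, rfl⟩ := Nat.exists_eq_add_of_le h
    simp only [and_comm (a := (_ + (b + d)) % (2 * N - 1) < N)]
    rw [card_overlap_add N b d (by omega), tau]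
    omega

/-- For nonnegative weights `w_0,…,w_{2N-2}` summing to `1`, and `χ` the indicator
of `{0,…,N-1}` inside `ℤ_{2N-1}`, we have
`Σ_s (Σ_r w_r χ((s+r) mod (2N-1)))² = N - Σ_{s,t} τ_{s,t,N} w_s w_t`. -/
theorem stmt1 (N : ℕ) (hN : 1 ≤ N) (w : ℕ → ℝ) (hw : ∀ r, 0 ≤ w r)
    (hsum : ∑ r ∈ Finset.range (2 * N - 1), w r = 1) :
    ∑ s ∈ Finset.range (2 * N - 1),
      (∑ r ∈ Finset.range (2 * N - 1),
        w r * (if (s + r) % (2 * N - 1) < N then (1 : ℝ) else 0)) ^ 2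
    = (N : ℝ) - ∑ s ∈ Finset.range (2 * N - 1), ∑ t ∈ Finset.range (2 * N - 1),
        (tau N s t : ℝ) * w s * w t := by
  set M := 2 * N - 1 with hM
  have hoverlap : ∀ a ∈ Finset.range M, ∀ b ∈ Finset.range M,
      ∑ s ∈ Finset.range M, (if (s + a) % M < N then (1 : ℝ) else 0)
        * (if (s + b) % M < N then (1 : ℝ) else 0) = N - tau N a b := by
    intro a ha b hb
    have h := card_overlap_add_tau N a b (Finset.mem_range.1 ha) (Finset.mem_range.1 hb)
    rw [eq_sub_iff_add_eq]
    simp only [ite_zero_mul_ite_zero, mul_one, Finset.sum_boole]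
    exact_mod_cast h
  have hN_eq : (N : ℝ) = ∑ a ∈ Finset.range M, ∑ b ∈ Finset.range M, (N : ℝ) * w a * w b := by
    simp only [← Finset.mul_sum, hsum, mul_one]
  simp only [sq, Finset.sum_mul_sum]
  rw [Finset.sum_comm]
  conv_rhs => rw [hN_eq]
  rw [← Finset.sum_sub_distrib]
  refine Finset.sum_congr rfl fun a ha => ?_
  rw [Finset.sum_comm, ← Finset.sum_sub_distrib]
  refine Finset.sum_congr rfl fun b hb => ?_
  rw [← sub_mul, ← sub_mul, ← hoverlap a ha b hb, Finset.sum_mul, Finset.sum_mul]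
  exact Finset.sum_congr rfl fun s _ => by ring
end

section
/- Let N ≥ 2 and K ≥ 1. Let A = [a_{k,n}] be a K × (N−1) matrix with entries in Z_N such that each row has pairwise distinct entries (condition C1), and for any ordered pair (a,b) of distinct elements of Z_N and any 1 ≤ m ≤ N−2, there is at most one row k and index j with a_{k,j} = a and a_{k,j+m} = b (condition C2). Let b: {0,...,N−1}² → ℤ and r ≥ 2 be such that the N × N matrix B with entries B_{i,j} = e^{2πi·b_{i,j}/r} satisfies B·B^H = N·I_N. Define, for 0 ≤ k < K, 0 ≤ m < N, 0 ≤ n < N−1, the sequences c^(k)_m(n) = B_{a_{k,n}, m}, each of length N−1. Then for every k and every pair of integers (τ,v) ≠ (0,0) with |τ| ≤ N−2 and |v| ≤ N−2, the auto-ambiguity sum vanishes: Σ_{m=0}^{N−1} AF_{c^(k)_m}(τ,v) = 0, where the Doppler exponential in AF uses the root e^{2πi/(N−1)}. -/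
/-- The aperiodic ambiguity function of two length-`L` complex sequences
(given as functions `ℤ → ℂ`, only the values at indices `0,…,L-1` matter)
at delay `τ` and Doppler `v`; the Doppler root of unity is `e^{2πi/L}`. -/
noncomputable def AF (L : ℕ) (a b : ℤ → ℂ) (τ v : ℤ) : ℂ :=
  ∑ t ∈ Finset.Icc (max 0 (-τ)) ((L : ℤ) - 1 - max 0 τ),
    a t * (starRingEnd ℂ) (b (t + τ)) *
      Complex.exp (2 * (Real.pi : ℂ) * Complex.I * (v : ℂ) * (t : ℂ) / (L : ℂ))

/-- The row inner products of a matrix with `B * Bᴴ = N • 1`. -/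
theorem sum_mul_conj_of_mul_conjTranspose {N : ℕ} {B : Matrix (Fin N) (Fin N) ℂ}
    (hB : B * B.conjTranspose = (N : ℂ) • 1) (i j : Fin N) :
    ∑ m, B i m * (starRingEnd ℂ) (B j m) = if i = j then (N : ℂ) else 0 := by
  have h := congrFun (congrFun hB i) j
  simpa [Matrix.mul_apply, Matrix.one_apply] using h

/-- A nontrivial additive character of `ℤ / L` sums to zero over `0, …, L - 1`. -/
theorem sum_Icc_exp_eq_zero {L : ℕ} (hL : L ≠ 0) {v : ℤ} (hv : ¬ (L : ℤ) ∣ v) :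
    ∑ t ∈ Finset.Icc (0 : ℤ) ((L : ℤ) - 1),
      Complex.exp (2 * (Real.pi : ℂ) * Complex.I * (v : ℂ) * (t : ℂ) / (L : ℂ)) = 0 := by
  have hζ := Complex.isPrimitiveRoot_exp L hL
  set ζ := Complex.exp (2 * Real.pi * Complex.I / L) with hζdef
  have hne : ζ ^ v ≠ 1 := fun h => hv ((hζ.zpow_eq_one_iff_dvd v).1 h)
  have hpow : (ζ ^ v) ^ L = 1 := by
    rw [← zpow_natCast, ← zpow_mul, mul_comm, zpow_mul, zpow_natCast, hζ.pow_eq_one, one_zpow]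
  have hsum : ∑ t ∈ Finset.range L, (ζ ^ v) ^ t = 0 := by
    rw [geom_sum_eq hne, hpow, sub_self, zero_div]
  rw [← hsum]
  symm
  refine Finset.sum_bij (fun t _ => (t : ℤ)) ?_ ?_ ?_ ?_
  · intro t ht
    rw [Finset.mem_range] at ht
    rw [Finset.mem_Icc]
    omega
  · intro s _ t _ h
    exact_mod_cast h
  · intro t ht
    rw [Finset.mem_Icc] at ht
    exact ⟨t.toNat, by rw [Finset.mem_range]; omega, by omega⟩
  · intro t _
    rw [hζdef, ← Complex.exp_int_mul, ← Complex.exp_nat_mul]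
    congr 1
    push_cast
    ring

/-- Construction from a quasi-Florentine rectangle `A` and a Butson-type Hadamard
matrix `B`: the auto-ambiguity sum of each constructed complementary set vanishes
on the whole zone `(-(N-1), N-1) × (-(N-1), N-1)` away from the origin. -/
theorem stmt13 (N K : ℕ) (hN : 2 ≤ N) (hK : 1 ≤ K)
    (A : Fin K → Fin (N - 1) → Fin N)
    -- C1: each row of the quasi-Florentine rectangle has pairwise distinct entries
    (hC1 : ∀ k, Function.Injective (A k))
    -- C2: for distinct symbols a,b and gap 1 ≤ m ≤ N-2, at most one (row, position)
    (hC2 : ∀ (a b : Fin N), a ≠ b → ∀ m : ℕ, 1 ≤ m → m ≤ N - 2 →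
      ∀ (k1 k2 : Fin K) (j1 j2 : ℕ) (h1 : j1 + m < N - 1) (h2 : j2 + m < N - 1),
        A k1 ⟨j1, by omega⟩ = a → A k1 ⟨j1 + m, h1⟩ = b →
        A k2 ⟨j2, by omega⟩ = a → A k2 ⟨j2 + m, h2⟩ = b → k1 = k2 ∧ j1 = j2)
    -- B is a Butson-type Hadamard matrix BH(N, r)
    (r : ℕ) (hr : 2 ≤ r) (e : Fin N → Fin N → ℤ)
    (B : Matrix (Fin N) (Fin N) ℂ)
    (hBe : ∀ i j, B i j =
      Complex.exp (2 * (Real.pi : ℂ) * Complex.I * (e i j : ℂ) / (r : ℂ)))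
    (hB : B * B.conjTranspose = (N : ℂ) • 1)
    -- the constructed sequences c^(k)_m of length N-1
    (c : Fin K → Fin N → ℤ → ℂ)
    (hc : ∀ (k : Fin K) (m : Fin N) (n : Fin (N - 1)),
      c k m ((n : ℕ) : ℤ) = B (A k n) m) :
    ∀ (k : Fin K) (τ v : ℤ), ¬(τ = 0 ∧ v = 0) →
      |τ| ≤ (N : ℤ) - 2 → |v| ≤ (N : ℤ) - 2 →
      ∑ m : Fin N, AF (N - 1) (c k m) (c k m) τ v = 0 := by
  intro k τ v hτv hτ hv
  have hL : N - 1 ≠ 0 := by omega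
  rw [abs_le] at hτ hv
  have hinner : ∀ t ∈ Finset.Icc (max 0 (-τ)) (((N - 1 : ℕ) : ℤ) - 1 - max 0 τ),
      ∑ m, c k m t * (starRingEnd ℂ) (c k m (t + τ)) = if τ = 0 then (N : ℂ) else 0 := by
    intro t ht
    rw [Finset.mem_Icc] at ht
    obtain ⟨x, hx⟩ : ∃ x : Fin (N - 1), ((x : ℕ) : ℤ) = t :=
      ⟨⟨t.toNat, by omega⟩, by simp only; omega⟩
    obtain ⟨y, hy⟩ : ∃ y : Fin (N - 1), ((y : ℕ) : ℤ) = t + τ :=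
      ⟨⟨(t + τ).toNat, by omega⟩, by simp only; omega⟩
    have hxy : A k x = A k y ↔ τ = 0 := by
      rw [(hC1 k).eq_iff, Fin.ext_iff]
      omega
    rw [← hy, ← hx]
    simp only [hc, sum_mul_conj_of_mul_conjTranspose hB, hxy]
  simp only [AF]
  rw [Finset.sum_comm]
  simp only [← Finset.sum_mul]
  rw [Finset.sum_congr rfl fun t ht => by rw [hinner t ht]]
  split_ifs with h0
  · subst h0
    have hdvd : ¬ ((N - 1 : ℕ) : ℤ) ∣ v := by
      intro h
      refine hτv ⟨rfl, Int.eq_zero_of_abs_lt_dvd h ?_⟩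
      rw [abs_lt]
      omega
    rw [← Finset.mul_sum]
    simpa using Or.inr (sum_Icc_exp_eq_zero hL hdvd)
  · simp
end

section
/- The sequence of optimality factors of the constructed DRCSs tends to 1: with K = N, M = N, sequence length N−1, Z_y = N−1 and θ_max = N, the quantity ρ_N = N / √( N·(N−1)·( 1 − 2·√( N/(3·N·(N−1)) ) ) ) = N / √( N·(N−1)·( 1 − 2·√( 1/(3·(N−1)) ) ) ) satisfies lim_{N→∞} ρ_N = 1. -/
/-- The optimality factors `ρ_N = N / √(N(N-1)(1 - 2√(N/(3N(N-1)))))` of the constructed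
DRCS sets (with `K = N`, `M = N`, length `N-1`, `Z_y = N-1`, `θ_max = N`) tend to `1`. -/
theorem stmt16 :
    Filter.Tendsto
      (fun N : ℕ => (N : ℝ) /
        Real.sqrt ((N : ℝ) * ((N : ℝ) - 1) *
          (1 - 2 * Real.sqrt ((N : ℝ) / (3 * (N : ℝ) * ((N : ℝ) - 1))))))
      Filter.atTop (nhds 1) := by
  have h_inv : Filter.Tendsto (fun N : ℕ => ((N : ℝ))⁻¹) Filter.atTop (nhds 0) :=
    tendsto_inv_atTop_zero.comp tendsto_natCast_atTop_atTop
  have h_inv_sub : Filter.Tendsto (fun N : ℕ => ((N : ℝ) - 1)⁻¹) Filter.atTop (nhds 0) :=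
    tendsto_inv_atTop_zero.comp
      (Filter.tendsto_atTop_add_const_right _ (-1) tendsto_natCast_atTop_atTop)
  have h_lim : Filter.Tendsto
      (fun N : ℕ => (Real.sqrt ((1 - (N : ℝ)⁻¹) *
        (1 - 2 * Real.sqrt (1 / 3 * ((N : ℝ) - 1)⁻¹))))⁻¹) Filter.atTop (nhds 1) := by
    have h := (((h_inv.const_sub 1).mul
      (((h_inv_sub.const_mul (1 / 3)).sqrt.const_mul 2).const_sub 1)).sqrt).inv₀ (by simp)
    simpa using h
  refine h_lim.congr' ?_
  filter_upwards [Filter.eventually_ge_atTop 2] with N hN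
  have hN' : (2 : ℝ) ≤ N := by exact_mod_cast hN
  have h0 : (N : ℝ) ≠ 0 := by positivity
  have h1 : (N : ℝ) - 1 ≠ 0 := by linarith
  have h_inner : (N : ℝ) / (3 * N * (N - 1)) = 1 / 3 * ((N : ℝ) - 1)⁻¹ := by
    field_simp
  rw [h_inner]
  generalize 1 - 2 * Real.sqrt (1 / 3 * ((N : ℝ) - 1)⁻¹) = c
  have h_outer : (N : ℝ) * (N - 1) * c = (N : ℝ) ^ 2 * ((1 - (N : ℝ)⁻¹) * c) := by
    field_simp
  rw [h_outer, Real.sqrt_mul (sq_nonneg _), Real.sqrt_sq (Nat.cast_nonneg N),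
    div_mul_eq_div_div, div_self h0, one_div]
end

section
/- Let N ≥ 2 and let A be a K × (N−1) matrix over Z_N satisfying: (C1) each row has pairwise distinct entries; (C2) for any ordered pair (a,b) of distinct elements of Z_N and any integer 1 ≤ m ≤ N−2, there is at most one row k and index j with A_{k,j} = a and A_{k,j+m} = b. Then for any two distinct row indices k1 ≠ k2 and any integer τ with 0 ≤ τ < N−1, the equation A_{k1, j} = A_{k2, j+τ} has at most one solution j subject to 0 ≤ j and j + τ < N−1. -/
/-- Key property of quasi-Florentine rectangles: for distinct rows `k1 ≠ k2` and any
shift `0 ≤ τ < N-1`, the equation `A_{k1,j} = A_{k2,j+τ}` has at most one solution `j`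
with `0 ≤ j` and `j + τ < N-1`. -/
theorem stmt17 (N K : ℕ) (hN : 2 ≤ N)
    (A : Fin K → Fin (N - 1) → Fin N)
    -- C1: each row has pairwise distinct entries
    (hC1 : ∀ k, Function.Injective (A k))
    -- C2: for distinct symbols a,b and gap 1 ≤ m ≤ N-2, at most one (row, position)
    (hC2 : ∀ (a b : Fin N), a ≠ b → ∀ m : ℕ, 1 ≤ m → m ≤ N - 2 →
      ∀ (k1 k2 : Fin K) (j1 j2 : ℕ) (h1 : j1 + m < N - 1) (h2 : j2 + m < N - 1),
        A k1 ⟨j1, by omega⟩ = a → A k1 ⟨j1 + m, h1⟩ = b →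
        A k2 ⟨j2, by omega⟩ = a → A k2 ⟨j2 + m, h2⟩ = b → k1 = k2 ∧ j1 = j2)
    (k1 k2 : Fin K) (hk : k1 ≠ k2) (τ : ℕ) (hτ : τ < N - 1) :
    ∀ (j1 j2 : ℕ) (h1 : j1 + τ < N - 1) (h2 : j2 + τ < N - 1),
      A k1 ⟨j1, by omega⟩ = A k2 ⟨j1 + τ, h1⟩ →
      A k1 ⟨j2, by omega⟩ = A k2 ⟨j2 + τ, h2⟩ → j1 = j2 := by
  have no_lt : ∀ (i j : ℕ) (hi : i + τ < N - 1) (hj : j + τ < N - 1),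
      A k1 ⟨i, by omega⟩ = A k2 ⟨i + τ, hi⟩ →
      A k1 ⟨j, by omega⟩ = A k2 ⟨j + τ, hj⟩ → ¬ i < j := by
    intro i j hi hj ei ej hij
    obtain ⟨m, rfl⟩ := Nat.exists_eq_add_of_lt hij
    have hne : A k1 ⟨i, by omega⟩ ≠ A k1 ⟨i + (m + 1), by omega⟩ := fun h => by
      have := congrArg Fin.val (hC1 k1 h)
      simp only at this
      omega
    refine hk (hC2 _ _ hne (m + 1) (by omega) (by omega) k1 k2 i (i + τ)
      (by omega) (by omega) rfl rfl ei.symm ?_).1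
    refine Eq.trans ?_ ej.symm
    congr 2
    omega
  intro i j hi hj ei ej
  exact le_antisymm (not_lt.mp (no_lt j i hj hi ej ei)) (not_lt.mp (no_lt i j hi hj ei ej))
end

section
/- Let p be a prime, n ≥ 1, q = p^n, and let α be a primitive element of the finite field F_q (a generator of the multiplicative group F_q^*), so that {1, α, α², ..., α^{n−1}} is a basis of F_q over F_p. Define ψ: F_q → Z_q by ψ(a_0 + a_1·α + ... + a_{n−1}·α^{n−1}) = a_0 + a_1·p + ... + a_{n−1}·p^{n−1}, where a_i ∈ {0,1,...,p−1} are the coordinates in this basis. Define the q × (q−1) matrix A by A_{0,j} = ψ(α^j) and A_{i,j} = ψ(α^j + α^{i−1}) for 1 ≤ i ≤ q−1, 0 ≤ j ≤ q−2. Then A is a quasi-Florentine rectangle over Z_q: each row of A has q−1 pairwise distinct entries, and for any ordered pair (a,b) of distinct elements of Z_q and any integer 1 ≤ m ≤ q−2, there is at most one pair (i,j) with A_{i,j} = a and A_{i,j+m} = b. -/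
/-- The base-`p` value determines the digits. -/
theorem digits_injective_of_sum_mul_pow {p n : ℕ} {c d : Fin n → ℕ}
    (hc : ∀ i, c i < p) (hd : ∀ i, d i < p)
    (h : ∑ i : Fin n, c i * p ^ (i : ℕ) = ∑ i : Fin n, d i * p ^ (i : ℕ)) : c = d := by
  have key : (fun i => (⟨c i, hc i⟩ : Fin p)) = fun i => ⟨d i, hd i⟩ := by
    apply finFunctionFinEquiv.injective
    apply Fin.ext
    simpa only [finFunctionFinEquiv_apply] using h
  funext i
  simpa using congrFun key i

/-- A primitive element of a field with a unit other than `1` is nonzero. -/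
theorem ne_zero_of_forall_exists_pow {F : Type*} [Field F] [Fintype F] {α : F}
    (hα : ∀ x : F, x ≠ 0 → ∃ k : ℕ, α ^ k = x) (hF : 1 < Fintype.card F - 1) : α ≠ 0 := by
  classical
  rintro rfl
  rw [← Fintype.card_units] at hF
  obtain ⟨x, hx⟩ := Fintype.exists_ne_of_one_lt_card hF (1 : Fˣ)
  obtain ⟨k, hk⟩ := hα x x.ne_zero
  rcases Nat.eq_zero_or_pos k with rfl | hk0
  · exact hx (Units.ext (by simpa using hk.symm))
  · exact x.ne_zero (hk.symm.trans (zero_pow (Nat.pos_iff_ne_zero.1 hk0)))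

/-- The powers `α ^ j` with `j < q - 1` of a primitive element `α` of a field with `q`
elements are pairwise distinct. -/
theorem pow_inj_of_forall_exists_pow {F : Type*} [Field F] [Fintype F] {α : F}
    (hα : ∀ x : F, x ≠ 0 → ∃ k : ℕ, α ^ k = x) {j k : ℕ}
    (hj : j < Fintype.card F - 1) (hk : k < Fintype.card F - 1) (h : α ^ j = α ^ k) :
    j = k := by
  classical
  rcases le_or_gt (Fintype.card F - 1) 1 with hF | hF
  · omega
  · have h0 := ne_zero_of_forall_exists_pow hα hF
    rw [← Fintype.card_units] at hj hk
    have hord : orderOf (Units.mk0 α h0) = Nat.card Fˣ := by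
      refine orderOf_eq_card_of_forall_mem_zpowers fun x => ?_
      obtain ⟨k, hk⟩ := hα x x.ne_zero
      exact ⟨k, Units.ext (by simpa using hk)⟩
    rw [Nat.card_eq_fintype_card] at hord
    refine pow_injOn_Iio_orderOf (x := Units.mk0 α h0) (by simpa [hord] using hj)
      (by simpa [hord] using hk) (Units.ext ?_)
    simpa using h

/-- The matrix `A` over `ℤ_q` (`q = pⁿ`) built from a primitive element `α` of `F_q`
via the base-`p` coordinate encoding `ψ` — `A_{0,j} = ψ(αʲ)`,
`A_{i,j} = ψ(αʲ + α^{i-1})` for `1 ≤ i ≤ q-1` — is a quasi-Florentine rectangle: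
each row has `q-1` pairwise distinct entries, and for any ordered pair of distinct
symbols and any gap `1 ≤ m ≤ q-2` there is at most one occurrence. -/
theorem stmt18 (p n : ℕ) (hp : p.Prime) (hn : 1 ≤ n)
    (F : Type*) [Field F] [Fintype F] (hcard : Fintype.card F = p ^ n)
    -- α is a primitive element: it generates the multiplicative group of F
    (α : F) (hα : ∀ x : F, x ≠ 0 → ∃ k : ℕ, α ^ k = x)
    -- {1, α, …, α^{n-1}} is a basis of F over F_p: every element has a unique
    -- coordinate representation with digits in {0,…,p-1}
    (hbasis : ∀ x : F, ∃! c : Fin n → ℕ,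
      (∀ i, c i < p) ∧ x = ∑ i : Fin n, (c i : F) * α ^ (i : ℕ))
    -- ψ is the base-p encoding of the coordinates
    (ψ : F → ℕ)
    (hψ : ∀ (x : F) (c : Fin n → ℕ), (∀ i, c i < p) →
      x = ∑ i : Fin n, (c i : F) * α ^ (i : ℕ) →
      ψ x = ∑ i : Fin n, c i * p ^ (i : ℕ))
    -- the matrix A of size q × (q-1)
    (A : ℕ → ℕ → ℕ)
    (hA0 : ∀ j, j < p ^ n - 1 → A 0 j = ψ (α ^ j))
    (hAi : ∀ i, 0 < i → i < p ^ n → ∀ j, j < p ^ n - 1 →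
      A i j = ψ (α ^ j + α ^ (i - 1))) :
    -- C1: each row has pairwise distinct entries
    (∀ i, i < p ^ n → ∀ j1 j2, j1 < p ^ n - 1 → j2 < p ^ n - 1 →
      A i j1 = A i j2 → j1 = j2) ∧
    -- C2: for distinct symbols a,b and gap 1 ≤ m ≤ q-2, at most one pair (i,j)
    (∀ a b : ℕ, a ≠ b → ∀ m, 1 ≤ m → m ≤ p ^ n - 2 →
      ∀ i1 i2 j1 j2, i1 < p ^ n → i2 < p ^ n →
        j1 + m < p ^ n - 1 → j2 + m < p ^ n - 1 →
        A i1 j1 = a → A i1 (j1 + m) = b → A i2 j2 = a → A i2 (j2 + m) = b →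
        i1 = i2 ∧ j1 = j2) := by
  have hψinj : Function.Injective ψ := by
    intro x y hxy
    obtain ⟨c, ⟨hc, hx⟩, -⟩ := hbasis x
    obtain ⟨d, ⟨hd, hy⟩, -⟩ := hbasis y
    rw [hψ x c hc hx, hψ y d hd hy] at hxy
    rw [hx, hy, digits_injective_of_sum_mul_pow hc hd hxy]
  have hpow : ∀ j k, j < p ^ n - 1 → k < p ^ n - 1 → α ^ j = α ^ k → j = k :=
    fun j k hj hk => pow_inj_of_forall_exists_pow hα (hcard ▸ hj) (hcard ▸ hk)
  -- Row `i` is the row of powers translated by `β i`.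
  obtain ⟨β, hβ0, hβ⟩ : ∃ β : ℕ → F, β 0 = 0 ∧ ∀ i, 0 < i → β i = α ^ (i - 1) :=
    ⟨fun i => if i = 0 then 0 else α ^ (i - 1), by simp, fun i hi => by simp [hi.ne']⟩
  have hA : ∀ i j, i < p ^ n → j < p ^ n - 1 → A i j = ψ (α ^ j + β i) := by
    intro i j hi hj
    rcases Nat.eq_zero_or_pos i with rfl | h
    · rw [hA0 j hj, hβ0, add_zero]
    · rw [hAi i h hi j hj, hβ i h]
  refine ⟨fun i hi j1 j2 h1 h2 h => ?_, ?_⟩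
  · rw [hA i j1 hi h1, hA i j2 hi h2] at h
    exact hpow j1 j2 h1 h2 (add_right_cancel (hψinj h))
  · intro a b _ m hm _ i1 i2 j1 j2 hi1 hi2 hj1 hj2 ha1 hb1 ha2 hb2
    have hα0 : α ≠ 0 := ne_zero_of_forall_exists_pow hα (by omega)
    have hβinj : β i1 = β i2 → i1 = i2 := by
      intro h
      rcases Nat.eq_zero_or_pos i1 with rfl | h1 <;> rcases Nat.eq_zero_or_pos i2 with rfl | h2
      · rfl
      · rw [hβ0, hβ i2 h2] at h
        exact absurd h.symm (pow_ne_zero _ hα0)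
      · rw [hβ0, hβ i1 h1] at h
        exact absurd h (pow_ne_zero _ hα0)
      · rw [hβ i1 h1, hβ i2 h2] at h
        have := hpow _ _ (by omega) (by omega) h
        omega
    have ha : α ^ j1 + β i1 = α ^ j2 + β i2 := hψinj <| by
      rw [← hA i1 j1 hi1 (by omega), ← hA i2 j2 hi2 (by omega), ha1, ha2]
    have hb : α ^ (j1 + m) + β i1 = α ^ (j2 + m) + β i2 := hψinj <| by
      rw [← hA i1 _ hi1 hj1, ← hA i2 _ hi2 hj2, hb1, hb2]
    have hm1 : α ^ m - 1 ≠ 0 := fun h => by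
      have := hpow m 0 (by omega) (by omega) (by simpa [sub_eq_zero] using h)
      omega
    have hj : α ^ j1 = α ^ j2 := mul_right_cancel₀ hm1 <| by
      rw [pow_add, pow_add] at hb
      linear_combination hb - ha
    refine ⟨hβinj ?_, hpow _ _ (by omega) (by omega) hj⟩
    rw [hj] at ha
    exact add_left_cancel ha
end

section
/- Let p be a prime, n ≥ 1, q = p^n, α a primitive element of F_q, ψ: F_q → Z_q the base-p coordinate encoding with respect to the basis {1, α, ..., α^{n−1}}, and let A be the q × (q−1) matrix with A_{0,j} = ψ(α^j) and A_{i,j} = ψ(α^j + α^{i−1}) for 1 ≤ i ≤ q−1. Let A' be the q × q matrix over Z_{q+1} obtained from A by prepending a leftmost column whose entries are all equal to q. Then A' is a quasi-Florentine rectangle of size q × q over Z_{q+1}: each row of A' has q pairwise distinct entries from Z_{q+1}, and for any ordered pair (a,b) of distinct elements of Z_{q+1} and any integer 1 ≤ m ≤ q−1, there is at most one pair (i,j) with A'_{i,j} = a and A'_{i,j+m} = b. -/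
/-- A map that encodes the digits of every element in base `p` is injective with values
below `p ^ n`. -/
theorem digit_encoding_lt_and_injective {F : Type*} [Field F] {p n : ℕ} {α : F}
    (hexists : ∀ x : F, ∃ c : Fin n → ℕ,
      (∀ i, c i < p) ∧ x = ∑ i : Fin n, (c i : F) * α ^ (i : ℕ))
    {ψ : F → ℕ}
    (hψ : ∀ (x : F) (c : Fin n → ℕ), (∀ i, c i < p) →
      x = ∑ i : Fin n, (c i : F) * α ^ (i : ℕ) →
      ψ x = ∑ i : Fin n, c i * p ^ (i : ℕ)) :
    (∀ x, ψ x < p ^ n) ∧ Function.Injective ψ := by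
  have key : ∀ x, ∃ d : Fin n → Fin p, x = ∑ i : Fin n, ((d i : ℕ) : F) * α ^ (i : ℕ) ∧
      ψ x = (finFunctionFinEquiv d : ℕ) := by
    intro x
    obtain ⟨c, hc, hx⟩ := hexists x
    exact ⟨fun i => ⟨c i, hc i⟩, hx, by rw [finFunctionFinEquiv_apply]; exact hψ x c hc hx⟩
  refine ⟨fun x => ?_, fun x y hxy => ?_⟩
  · obtain ⟨d, -, hd⟩ := key x
    rw [hd]
    exact (finFunctionFinEquiv d).isLt
  · obtain ⟨d, hx, hd⟩ := key x
    obtain ⟨e, hy, he⟩ := key y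
    have hde : d = e := finFunctionFinEquiv.injective (Fin.ext (by rw [← hd, ← he, hxy]))
    rw [hx, hy, hde]

/-- If the powers of `α` cover all nonzero elements of a finite field with `q` elements, then
`α ^ j` for `j < q - 1` are nonzero and pairwise distinct. -/
theorem pow_ne_zero_and_injOn_of_forall_exists_pow {F : Type*} [Field F] [Fintype F] {α : F}
    (hα : ∀ x : F, x ≠ 0 → ∃ k : ℕ, α ^ k = x) :
    (∀ j < Fintype.card F - 1, α ^ j ≠ 0) ∧
      Set.InjOn (fun j : ℕ => α ^ j) (Set.Iio (Fintype.card F - 1)) := by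
  classical
  by_cases h0 : α = 0
  · have hsub : Subsingleton Fˣ := by
      refine subsingleton_of_forall_eq 1 fun u => Units.ext ?_
      obtain ⟨k, hk⟩ := hα u u.ne_zero
      rcases Nat.eq_zero_or_pos k with rfl | hk0
      · simpa using hk.symm
      · rw [h0, zero_pow hk0.ne'] at hk
        exact absurd hk.symm u.ne_zero
    have hq : Fintype.card F - 1 ≤ 1 := by
      rw [← Fintype.card_units]
      exact Fintype.card_le_one_iff_subsingleton.mpr hsub
    refine ⟨fun j hj => ?_, fun i hi j hj _ => ?_⟩
    · obtain rfl : j = 0 := by lia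
      simp
    · simp only [Set.mem_Iio] at hi hj
      lia
  · refine ⟨fun j _ => pow_ne_zero j h0, fun i hi j hj hij => ?_⟩
    have hord : orderOf (Units.mk0 α h0) = Fintype.card F - 1 := by
      rw [← Fintype.card_units, ← Nat.card_eq_fintype_card]
      refine orderOf_eq_card_of_forall_mem_zpowers fun u => ?_
      obtain ⟨k, hk⟩ := hα u u.ne_zero
      exact ⟨k, Units.ext (by simpa using hk)⟩
    rw [← hord] at hi hj
    exact pow_injOn_Iio_orderOf hi hj (Units.ext (by simpa using hij))

/-- Prepending to the quasi-Florentine rectangle `A` (built from a primitive element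
`α` of `F_q`, `q = pⁿ`, via the base-`p` encoding `ψ`) a leftmost all-`q` column gives
a `q × q` quasi-Florentine rectangle `A'` over `ℤ_{q+1}`: each row of `A'` has `q`
pairwise distinct entries from `ℤ_{q+1}`, and for any ordered pair of distinct symbols
and any gap `1 ≤ m ≤ q-1` there is at most one occurrence. -/
theorem stmt19 (p n : ℕ) (hp : p.Prime) (hn : 1 ≤ n)
    (F : Type*) [Field F] [Fintype F] (hcard : Fintype.card F = p ^ n)
    -- α is a primitive element: it generates the multiplicative group of F
    (α : F) (hα : ∀ x : F, x ≠ 0 → ∃ k : ℕ, α ^ k = x)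
    -- {1, α, …, α^{n-1}} is a basis of F over F_p: every element has a unique
    -- coordinate representation with digits in {0,…,p-1}
    (hbasis : ∀ x : F, ∃! c : Fin n → ℕ,
      (∀ i, c i < p) ∧ x = ∑ i : Fin n, (c i : F) * α ^ (i : ℕ))
    -- ψ is the base-p encoding of the coordinates
    (ψ : F → ℕ)
    (hψ : ∀ (x : F) (c : Fin n → ℕ), (∀ i, c i < p) →
      x = ∑ i : Fin n, (c i : F) * α ^ (i : ℕ) →
      ψ x = ∑ i : Fin n, c i * p ^ (i : ℕ))
    -- the matrix A of size q × (q-1)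
    (A : ℕ → ℕ → ℕ)
    (hA0 : ∀ j, j < p ^ n - 1 → A 0 j = ψ (α ^ j))
    (hAi : ∀ i, 0 < i → i < p ^ n → ∀ j, j < p ^ n - 1 →
      A i j = ψ (α ^ j + α ^ (i - 1)))
    -- A' is A with an extra leftmost column with all entries equal to q = pⁿ
    (A' : ℕ → ℕ → ℕ)
    (hA'0 : ∀ i, i < p ^ n → A' i 0 = p ^ n)
    (hA'j : ∀ i, i < p ^ n → ∀ j, j < p ^ n - 1 → A' i (j + 1) = A i j) :
    -- entries lie in ℤ_{q+1}
    (∀ i, i < p ^ n → ∀ j, j < p ^ n → A' i j < p ^ n + 1) ∧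
    -- C1: each row of A' has pairwise distinct entries
    (∀ i, i < p ^ n → ∀ j1 j2, j1 < p ^ n → j2 < p ^ n →
      A' i j1 = A' i j2 → j1 = j2) ∧
    -- C2: for distinct symbols a,b and gap 1 ≤ m ≤ q-1, at most one pair (i,j)
    (∀ a b : ℕ, a ≠ b → ∀ m, 1 ≤ m → m ≤ p ^ n - 1 →
      ∀ i1 i2 j1 j2, i1 < p ^ n → i2 < p ^ n →
        j1 + m < p ^ n → j2 + m < p ^ n →
        A' i1 j1 = a → A' i1 (j1 + m) = b → A' i2 j2 = a → A' i2 (j2 + m) = b →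
        i1 = i2 ∧ j1 = j2) := by
  obtain ⟨hlt, hinj⟩ := digit_encoding_lt_and_injective (fun x => (hbasis x).exists) hψ
  obtain ⟨hne, hpow⟩ := pow_ne_zero_and_injOn_of_forall_exists_pow hα
  rw [hcard] at hne hpow
  replace hpow : ∀ i j, i < p ^ n - 1 → j < p ^ n - 1 → α ^ i = α ^ j → i = j :=
    fun i j hi hj h => hpow hi hj h
  obtain ⟨s, hs0, hs⟩ : ∃ s : ℕ → F, s 0 = 0 ∧ ∀ i, s (i + 1) = α ^ i :=
    ⟨fun i => Nat.casesOn i 0 fun i => α ^ i, rfl, fun _ => rfl⟩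
  have hsinj : ∀ i j, i < p ^ n → j < p ^ n → s i = s j → i = j := by
    rintro (_ | i) (_ | j) hi hj h
    · rfl
    · rw [hs0, hs] at h
      exact absurd h.symm (hne j (by lia))
    · rw [hs0, hs] at h
      exact absurd h (hne i (by lia))
    · rw [hs, hs] at h
      rw [hpow i j (by lia) (by lia) h]
  have hA' : ∀ i, i < p ^ n → ∀ j, j + 1 < p ^ n → A' i (j + 1) = ψ (α ^ j + s i) := by
    rintro (_ | i) hi j hj
    · rw [hA'j 0 hi j (by lia), hA0 j (by lia), hs0, add_zero]
    · rw [hA'j _ hi j (by lia), hAi (i + 1) i.succ_pos hi j (by lia), hs, Nat.add_sub_cancel]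
  have hA'lt : ∀ i, i < p ^ n → ∀ j, j + 1 < p ^ n → A' i (j + 1) < p ^ n :=
    fun i hi j hj => hA' i hi j hj ▸ hlt _
  refine ⟨?_, ?_, ?_⟩
  · rintro i hi (_ | j) hj
    · rw [hA'0 i hi]
      lia
    · exact (hA'lt i hi j hj).trans (Nat.lt_succ_self _)
  · rintro i hi (_ | j1) (_ | j2) h1 h2 h
    · rfl
    · exact absurd (h.symm.trans (hA'0 i hi)) (hA'lt i hi j2 h2).ne
    · exact absurd (h.trans (hA'0 i hi)) (hA'lt i hi j1 h1).ne
    · rw [hA' i hi j1 h1, hA' i hi j2 h2] at h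
      rw [hpow j1 j2 (by lia) (by lia) (add_right_cancel (hinj h))]
  · rintro a b - m hm - i1 i2 (_ | j1) (_ | j2) hi1 hi2 h1 h2 ha1 hb1 ha2 hb2
    · obtain ⟨m, rfl⟩ := Nat.exists_eq_add_of_le' hm
      rw [zero_add] at hb1 hb2 h1
      rw [← hb2, hA' i1 hi1 m h1, hA' i2 hi2 m h1] at hb1
      exact ⟨hsinj i1 i2 hi1 hi2 (add_left_cancel (hinj hb1)), rfl⟩
    · exact absurd (ha2.trans (ha1.symm.trans (hA'0 i1 hi1))) (hA'lt i2 hi2 j2 (by lia)).ne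
    · exact absurd (ha1.trans (ha2.symm.trans (hA'0 i2 hi2))) (hA'lt i1 hi1 j1 (by lia)).ne
    · rw [Nat.add_right_comm] at hb1 hb2 h1 h2
      rw [← ha2, hA' i1 hi1 j1 (by lia), hA' i2 hi2 j2 (by lia)] at ha1
      rw [← hb2, hA' i1 hi1 _ h1, hA' i2 hi2 _ h2] at hb1
      have hx := hinj ha1
      have hy := hinj hb1
      have hm1 : α ^ m - 1 ≠ 0 := by
        intro h
        have := hpow m 0 (by lia) (by lia) (by rw [pow_zero]; exact sub_eq_zero.mp h)
        lia
      have hj : α ^ j1 = α ^ j2 := by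
        refine mul_right_cancel₀ hm1 ?_
        rw [pow_add, pow_add] at hy
        linear_combination hy - hx
      rw [hj] at hx
      exact ⟨hsinj i1 i2 hi1 hi2 (add_left_cancel hx),
        by rw [hpow j1 j2 (by lia) (by lia) hj]⟩
end
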